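/- On a probability space (Ω, 𝓕, P), let U and V be independent standard normal random variables, let σ1, σ2 > 0 and ρ ∈ [−1, 1], and define Θ1 = exp(−σ1²/2 + σ1·U) and Θ2 = exp(−σ2²/2 + σ2·(ρ·U + √(1 − ρ²)·V)). Let N, S : Ω → ℝ be square-integrable random variables, let λ1, λ2 > 0, write G = σ(Θ1, Θ2) and H = σ(N, Θ1, Θ2), and assume N²·Θ2 is integrable, E[S | H] = N·λ2·Θ2 almost surely, and E[N | G] = λ1·Θ1 and E[N² | G] = λ1·Θ1 + (λ1·Θ1)² almost surely. Then Cov(N, S) = λ1·λ2·exp(ρ·σ1·σ2) + λ1²·λ2·(exp(σ1² + 2·ρ·σ1·σ2) − exp(ρ·σ1·σ2)). -/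

import Mathlib

open MeasureTheory ProbabilityTheory

theorem aux_exp {Ω : Type*} [MeasurableSpace Ω] (P : Measure Ω) [IsProbabilityMeasure P]
    (U V : Ω → ℝ) (hU : Measurable U) (hV : Measurable V)
    (hUV : IndepFun U V P)
    (hUlaw : P.map U = gaussianReal 0 1) (hVlaw : P.map V = gaussianReal 0 1) (a b c : ℝ) :
    ∫ ω, Real.exp (c + a * U ω + b * V ω) ∂P = Real.exp (c + a ^ 2 / 2 + b ^ 2 / 2) := by
  have h1 : IndepFun (fun ω => Real.exp (a * U ω)) (fun ω => Real.exp (b * V ω)) P :=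
    hUV.comp (φ := fun x => Real.exp (a * x)) (ψ := fun x => Real.exp (b * x))
      (by fun_prop) (by fun_prop)
  have h2 := h1.integral_fun_mul_eq_mul_integral
    (by fun_prop : Measurable fun ω => Real.exp (a * U ω)).aestronglyMeasurable
    (by fun_prop : Measurable fun ω => Real.exp (b * V ω)).aestronglyMeasurable
  have hu := mgf_gaussianReal hUlaw a
  have hv := mgf_gaussianReal hVlaw b
  simp only [mgf] at hu hv
  rw [hu, hv] at h2
  simp only [Real.exp_add, mul_assoc]
  rw [integral_const_mul, h2]
  simp

theorem aux_int {Ω : Type*} [MeasurableSpace Ω] (P : Measure Ω) [IsProbabilityMeasure P]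
    (U V : Ω → ℝ) (hU : Measurable U) (hV : Measurable V)
    (hUV : IndepFun U V P)
    (hUlaw : P.map U = gaussianReal 0 1) (hVlaw : P.map V = gaussianReal 0 1) (a b c : ℝ) :
    Integrable (fun ω => Real.exp (c + a * U ω + b * V ω)) P := by
  by_contra h
  have h2 := aux_exp P U V hU hV hUV hUlaw hVlaw a b c
  rw [integral_undef h] at h2
  exact (Real.exp_pos _).ne h2

theorem aux_pull {Ω : Type*} {m m0 : MeasurableSpace Ω} (P : Measure[m0] Ω) [IsProbabilityMeasure P]
    (hm : m ≤ m0) (X Y Z : Ω → ℝ) (hX : Measurable[m] X) (hY : Integrable Y P)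
    (hXY : Integrable (fun ω => X ω * Y ω) P) (h : P[Y | m] =ᵐ[P] Z) :
    ∫ ω, X ω * Y ω ∂P = ∫ ω, X ω * Z ω ∂P := by
  have h1 := condExp_mul_of_stronglyMeasurable_left (μ := P) (f := X) (g := Y)
    hX.stronglyMeasurable hXY hY
  rw [← integral_condExp hm (f := fun ω => X ω * Y ω)]
  apply integral_congr_ae
  filter_upwards [h1, h] with ω h1 h2
  rw [← h2]
  exact h1

theorem stmt_9 {Ω : Type*} [MeasurableSpace Ω] (P : Measure Ω) [IsProbabilityMeasure P]
    (U V : Ω → ℝ) (hU : Measurable U) (hV : Measurable V)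
    (hUV : IndepFun U V P)
    (hUlaw : P.map U = gaussianReal 0 1) (hVlaw : P.map V = gaussianReal 0 1)
    (σ1 σ2 : ℝ) (hσ1 : 0 < σ1) (hσ2 : 0 < σ2)
    (ρ : ℝ) (hρ : ρ ∈ Set.Icc (-1 : ℝ) 1)
    (Θ1 Θ2 : Ω → ℝ)
    (hΘ1 : Θ1 = fun ω => Real.exp (-σ1 ^ 2 / 2 + σ1 * U ω))
    (hΘ2 : Θ2 = fun ω =>
      Real.exp (-σ2 ^ 2 / 2 + σ2 * (ρ * U ω + Real.sqrt (1 - ρ ^ 2) * V ω)))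
    (N S : Ω → ℝ) (hN : Measurable N) (hSmeas : Measurable S)
    (hNsq : MemLp N 2 P) (hSsq : MemLp S 2 P)
    (l1 l2 : ℝ) (hl1 : 0 < l1) (hl2 : 0 < l2)
    (hint : Integrable (fun ω => N ω ^ 2 * Θ2 ω) P)
    (hSH : P[S | MeasurableSpace.comap N inferInstance ⊔ MeasurableSpace.comap Θ1 inferInstance
        ⊔ MeasurableSpace.comap Θ2 inferInstance] =ᵐ[P] fun ω => N ω * (l2 * Θ2 ω))
    (hNG : P[N | MeasurableSpace.comap Θ1 inferInstance ⊔ MeasurableSpace.comap Θ2 inferInstance]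
        =ᵐ[P] fun ω => l1 * Θ1 ω)
    (hN2G : P[(fun ω => N ω ^ 2) | MeasurableSpace.comap Θ1 inferInstance
        ⊔ MeasurableSpace.comap Θ2 inferInstance]
        =ᵐ[P] fun ω => l1 * Θ1 ω + (l1 * Θ1 ω) ^ 2) :
    (∫ ω, N ω * S ω ∂P) - (∫ ω, N ω ∂P) * (∫ ω, S ω ∂P)
      = l1 * l2 * Real.exp (ρ * σ1 * σ2)
        + l1 ^ 2 * l2 * (Real.exp (σ1 ^ 2 + 2 * ρ * σ1 * σ2) - Real.exp (ρ * σ1 * σ2)) := by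
  have hT1 : Measurable Θ1 := by rw [hΘ1]; fun_prop
  have hT2 : Measurable Θ2 := by rw [hΘ2]; fun_prop
  have hG : MeasurableSpace.comap Θ1 inferInstance ⊔ MeasurableSpace.comap Θ2 inferInstance
      ≤ (inferInstance : MeasurableSpace Ω) := sup_le hT1.comap_le hT2.comap_le
  have hH : MeasurableSpace.comap N inferInstance ⊔ MeasurableSpace.comap Θ1 inferInstance
      ⊔ MeasurableSpace.comap Θ2 inferInstance ≤ (inferInstance : MeasurableSpace Ω) :=
    sup_le (sup_le hN.comap_le hT1.comap_le) hT2.comap_le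
  have hNi : Integrable N P := hNsq.integrable (by norm_num)
  have hSi : Integrable S P := hSsq.integrable (by norm_num)
  have hN2i : Integrable (fun ω => N ω ^ 2) P := hNsq.integrable_sq
  have hNS : Integrable (fun ω => N ω * S ω) P := hNsq.integrable_mul hSsq
  have hNT : Integrable (fun ω => N ω * (l2 * Θ2 ω)) P := integrable_condExp.congr hSH
  have hTN : Integrable (fun ω => Θ2 ω * N ω) P := by
    refine (hNT.const_mul l2⁻¹).congr (ae_of_all _ fun ω => ?_)
    simp only
    field_simp
  have hr : Real.sqrt (1 - ρ ^ 2) ^ 2 = 1 - ρ ^ 2 :=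
    Real.sq_sqrt (by nlinarith [hρ.1, hρ.2])
  have e1 : ∫ ω, Θ1 ω ∂P = 1 := by
    have := aux_exp P U V hU hV hUV hUlaw hVlaw σ1 0 (-σ1 ^ 2 / 2)
    rw [hΘ1]
    convert this using 1
    · simp
    · symm; rw [Real.exp_eq_one_iff]; ring
  have f12 : (fun ω => Θ2 ω * Θ1 ω) = fun ω => Real.exp ((-σ1 ^ 2 / 2 - σ2 ^ 2 / 2)
      + (σ1 + σ2 * ρ) * U ω + (σ2 * Real.sqrt (1 - ρ ^ 2)) * V ω) := by
    funext ω
    rw [hΘ1, hΘ2]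
    simp only
    rw [← Real.exp_add]
    ring_nf
  have f112 : (fun ω => Θ2 ω * Θ1 ω ^ 2) = fun ω => Real.exp ((-σ1 ^ 2 - σ2 ^ 2 / 2)
      + (2 * σ1 + σ2 * ρ) * U ω + (σ2 * Real.sqrt (1 - ρ ^ 2)) * V ω) := by
    funext ω
    rw [hΘ1, hΘ2]
    simp only
    rw [← Real.exp_nat_mul, ← Real.exp_add]
    congr 1
    push_cast
    ring
  have i12 : Integrable (fun ω => Θ2 ω * Θ1 ω) P := by
    rw [f12]; exact aux_int P U V hU hV hUV hUlaw hVlaw _ _ _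
  have i112 : Integrable (fun ω => Θ2 ω * Θ1 ω ^ 2) P := by
    rw [f112]; exact aux_int P U V hU hV hUV hUlaw hVlaw _ _ _
  have e12 : ∫ ω, Θ2 ω * Θ1 ω ∂P = Real.exp (ρ * σ1 * σ2) := by
    rw [f12, aux_exp P U V hU hV hUV hUlaw hVlaw, mul_pow, hr]
    ring_nf
  have e112 : ∫ ω, Θ2 ω * Θ1 ω ^ 2 ∂P = Real.exp (σ1 ^ 2 + 2 * ρ * σ1 * σ2) := by
    rw [f112, aux_exp P U V hU hV hUV hUlaw hVlaw, mul_pow, hr]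
    ring_nf
  have EN : ∫ ω, N ω ∂P = l1 := by
    rw [← integral_condExp hG, integral_congr_ae hNG, integral_const_mul, e1, mul_one]
  have mT2 : Measurable[MeasurableSpace.comap Θ1 inferInstance
      ⊔ MeasurableSpace.comap Θ2 inferInstance] Θ2 :=
    (comap_measurable Θ2).mono le_sup_right le_rfl
  have mN : Measurable[MeasurableSpace.comap N inferInstance
      ⊔ MeasurableSpace.comap Θ1 inferInstance ⊔ MeasurableSpace.comap Θ2 inferInstance] N :=
    (comap_measurable N).mono (le_sup_left.trans le_sup_left) le_rfl
  have ES : ∫ ω, S ω ∂P = l2 * (l1 * Real.exp (ρ * σ1 * σ2)) := by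
    rw [← integral_condExp hH, integral_congr_ae hSH]
    have : ∀ ω, N ω * (l2 * Θ2 ω) = l2 * (Θ2 ω * N ω) := fun ω => by ring
    simp only [this]
    rw [integral_const_mul, aux_pull P hG Θ2 N _ mT2 hNi hTN hNG]
    have : ∀ ω, Θ2 ω * (l1 * Θ1 ω) = l1 * (Θ2 ω * Θ1 ω) := fun ω => by ring
    simp only [this]
    rw [integral_const_mul, e12]
  have ENS : ∫ ω, N ω * S ω ∂P = l2 * (l1 * Real.exp (ρ * σ1 * σ2)
      + l1 ^ 2 * Real.exp (σ1 ^ 2 + 2 * ρ * σ1 * σ2)) := by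
    rw [aux_pull P hH N S _ mN hSi hNS hSH]
    have : ∀ ω, N ω * (N ω * (l2 * Θ2 ω)) = l2 * (Θ2 ω * N ω ^ 2) := fun ω => by ring
    simp only [this]
    rw [integral_const_mul, aux_pull P hG Θ2 (fun ω => N ω ^ 2) _ mT2 hN2i
      (by simpa only [mul_comm] using hint) hN2G]
    have : ∀ ω, Θ2 ω * (l1 * Θ1 ω + (l1 * Θ1 ω) ^ 2)
      = l1 * (Θ2 ω * Θ1 ω) + l1 ^ 2 * (Θ2 ω * Θ1 ω ^ 2) := fun ω => by ring
    simp only [this]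
    rw [integral_add (i12.const_mul _) (i112.const_mul _), integral_const_mul,
      integral_const_mul, e12, e112]
  rw [EN, ES, ENS]
  ring
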